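/- arXiv:0704.3711 — 7 statements merged into one kernel-verified Lean document; each statement's English description precedes it below -/
import Mathlib

section
/- Let h : A → I and k : A → J be two H-injective envelopes of the same object A. Then there exists a morphism f : I → J with f ∘ h = k, and every morphism f : I → J satisfying f ∘ h = k is an isomorphism. In particular, any two H-injective envelopes of A are isomorphic. -/
open CategoryTheory

universe v u

variable {C : Type u} [Category.{v} C]

/-- An object `I` is `H`-injective if every morphism `f : A ⟶ I` extends along every
morphism `h : A ⟶ B` belonging to `H`. -/
def HInjective (H : MorphismProperty C) (I : C) : Prop :=
  ∀ ⦃A B : C⦄ (h : A ⟶ B), H h → ∀ f : A ⟶ I, ∃ g : B ⟶ I, h ≫ g = f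

/-- A morphism `h` is `H`-essential if for every composable morphism `g` one has
`H (h ≫ g) ↔ H g`. -/
def HEssential (H : MorphismProperty C) {A B : C} (h : A ⟶ B) : Prop :=
  ∀ ⦃D : C⦄ (g : B ⟶ D), H (h ≫ g) ↔ H g

/-- `ι : A ⟶ I` is an `H`-injective envelope of `A` if `I` is `H`-injective and
`ι` is an `H`-essential morphism belonging to `H`. -/
def IsHInjEnvelope (H : MorphismProperty C) {A I : C} (ι : A ⟶ I) : Prop :=
  HInjective H I ∧ H ι ∧ HEssential H ι

theorem stmt0 (H : MorphismProperty C)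
    (hcomp : ∀ {X Y Z : C} (f : X ⟶ Y) (g : Y ⟶ Z), H f → H g → H (f ≫ g))
    (hiso : ∀ {X Y : C} (f : X ⟶ Y), IsIso f → H f)
    {A I J : C} (h : A ⟶ I) (k : A ⟶ J)
    (hh : IsHInjEnvelope H h) (hk : IsHInjEnvelope H k) :
    (∃ f : I ⟶ J, h ≫ f = k) ∧ (∀ f : I ⟶ J, h ≫ f = k → IsIso f) := by
  refine ⟨hk.1 h hh.2.1 k, fun f hf => ?_⟩
  have hfH : H f := (hh.2.2 f).1 (hf ▸ hk.2.1)
  obtain ⟨g, hfg⟩ := hh.1 f hfH (𝟙 I)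
  have hkg : k ≫ g = h := by rw [← hf, Category.assoc, hfg, Category.comp_id]
  have hgH : H g := (hk.2.2 g).1 (hkg.symm ▸ hh.2.1)
  obtain ⟨f', hgf'⟩ := hk.1 g hgH (𝟙 J)
  have hff' : f = f' := by
    rw [← Category.comp_id f, ← hgf', ← Category.assoc, hfg, Category.id_comp]
  exact ⟨g, hfg, by rw [hff', hgf']⟩
end

section
/- Assume in addition that H contains every split monomorphism of C (i.e., every morphism g for which there exists a morphism r with r ∘ g = id). Let ι : E → I be a rigid morphism belonging to H into an H-injective object I. Then ι is H-essential; consequently I, together with ι, is an H-injective envelope of E. -/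
open CategoryTheory

universe v u

variable {C : Type u} [Category.{v} C]

/-- A morphism `ι : A ⟶ I` is rigid if the identity of `I` is the only endomorphism
`g : I ⟶ I` with `ι ≫ g = ι`. -/
def Rigid {A I : C} (ι : A ⟶ I) : Prop :=
  ∀ g : I ⟶ I, ι ≫ g = ι → g = 𝟙 I

theorem stmt1 (H : MorphismProperty C)
    (hcomp : ∀ {X Y Z : C} (f : X ⟶ Y) (g : Y ⟶ Z), H f → H g → H (f ≫ g))
    (hiso : ∀ {X Y : C} (f : X ⟶ Y), IsIso f → H f)
    (hsplit : ∀ {X Y : C} (g : X ⟶ Y), (∃ r : Y ⟶ X, g ≫ r = 𝟙 X) → H g)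
    {E I : C} (ι : E ⟶ I) (hι : H ι) (hrig : Rigid ι) (hinj : HInjective H I) :
    HEssential H ι ∧ IsHInjEnvelope H ι := by
  have hess : HEssential H ι := by
    intro D g
    refine ⟨fun hg => ?_, hcomp ι g hι⟩
    obtain ⟨r, hr⟩ := hinj (ι ≫ g) hg ι
    exact hsplit g ⟨r, hrig (g ≫ r) (by rw [← Category.assoc, hr])⟩
  exact ⟨hess, hinj, hι, hess⟩
end

section
/- Assume in addition that every morphism belonging to H is a monomorphism. Let ι : E → I be a rigid morphism belonging to H into an H-injective object I, and suppose that ι = k ∘ h where h : E → F and k : F → I both belong to H. Then both h and k are rigid. -/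
open CategoryTheory

universe v u

variable {C : Type u} [Category.{v} C]

theorem stmt2 (H : MorphismProperty C)
    (hcomp : ∀ {X Y Z : C} (f : X ⟶ Y) (g : Y ⟶ Z), H f → H g → H (f ≫ g))
    (hiso : ∀ {X Y : C} (f : X ⟶ Y), IsIso f → H f)
    (hmono : ∀ {X Y : C} (f : X ⟶ Y), H f → Mono f)
    {E F I : C} (ι : E ⟶ I) (hι : H ι) (hrig : Rigid ι) (hinj : HInjective H I)
    (h : E ⟶ F) (k : F ⟶ I) (hh : H h) (hk : H k) (hfac : ι = h ≫ k) :
    Rigid h ∧ Rigid k := by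
  subst hfac
  have := hmono k hk
  refine ⟨fun g hg => ?_, fun g hg => hrig g (by rw [Category.assoc, hg])⟩
  obtain ⟨g', hg'⟩ := hinj k hk (g ≫ k)
  have hid : g' = 𝟙 I := hrig g' (by rw [Category.assoc, hg', ← Category.assoc, hg])
  rw [hid, Category.comp_id] at hg'
  rw [← cancel_mono k, ← hg', Category.id_comp]
end

section
/- Let J be an algebraically essential closed right ideal of the C*-algebra A and let a ∈ A. Then a ≥ 0 if and only if x*ax ≥ 0 for all x ∈ J. -/
variable {A : Type*} [NonUnitalCStarAlgebra A] [PartialOrder A] [StarOrderedRing A]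

/-- A submodule `J ⊆ A` is a right ideal if it is closed under right multiplication
by arbitrary elements of `A`. -/
def IsRightIdeal (J : Submodule ℂ A) : Prop :=
  ∀ x ∈ J, ∀ a : A, x * a ∈ J

/-- A right ideal `J` is algebraically essential if it has nonzero intersection with every
nonzero right ideal of `A`. -/
def IsAlgEssential (J : Submodule ℂ A) : Prop :=
  ∀ K : Submodule ℂ A, IsRightIdeal K → K ≠ ⊥ → J ⊓ K ≠ ⊥

/-- An algebraically essential right ideal detects nonnegativity of selfadjoint elements. -/
theorem IsAlgEssential.nonneg_of_isSelfAdjoint {J : Submodule ℂ A} (hJ : IsAlgEssential J)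
    {a : A} (ha : IsSelfAdjoint a) (h : ∀ x ∈ J, 0 ≤ star x * a * x) : 0 ≤ a := by
  have hn : (0 : A) ≤ a⁻ := CFC.negPart_nonneg a
  have hsa : star a⁻ = a⁻ := (IsSelfAdjoint.of_nonneg hn).star_eq
  have hmul : a⁻ * a = -(a⁻ * a⁻) := by
    calc a⁻ * a = a⁻ * (a⁺ - a⁻) := by rw [CFC.posPart_sub_negPart a ha]
      _ = -(a⁻ * a⁻) := by rw [mul_sub, CFC.negPart_mul_posPart, zero_sub]
  suffices hzero : a⁻ = 0 by
    rw [← CFC.posPart_sub_negPart a ha, hzero, sub_zero]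
    exact CFC.posPart_nonneg a
  by_contra hne
  let K : Submodule ℂ A := LinearMap.range (LinearMap.mulLeft ℂ a⁻)
  have hK : IsRightIdeal K := by
    rintro _ ⟨d, rfl⟩ c
    exact ⟨d * c, by simp [mul_assoc]⟩
  have hK0 : K ≠ ⊥ := fun hbot => by
    have hmem : star a⁻ * a⁻ ∈ K := ⟨a⁻, by simp [hsa]⟩
    rw [hbot, Submodule.mem_bot, CStarRing.star_mul_self_eq_zero_iff] at hmem
    exact hne hmem
  obtain ⟨_, ⟨hxJ, d, rfl⟩, hx0⟩ := Submodule.exists_mem_ne_zero_of_ne_bot (hJ K hK hK0)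
  apply hx0
  have hx := h _ hxJ
  simp only [LinearMap.mulLeft_apply] at hx ⊢
  obtain ⟨s, hs⟩ := CStarAlgebra.nonneg_iff_eq_star_mul_self.mp hn
  have hneg : star (a⁻ * d) * a * (a⁻ * d) = -(star (s * (a⁻ * d)) * (s * (a⁻ * d))) := by
    calc star (a⁻ * d) * a * (a⁻ * d) = star d * (a⁻ * a) * (a⁻ * d) := by
          simp only [star_mul, hsa, mul_assoc]
      _ = -(star (a⁻ * d) * a⁻ * (a⁻ * d)) := by
          rw [hmul]; simp only [star_mul, hsa, mul_assoc, mul_neg, neg_mul]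
      _ = -(star (a⁻ * d) * (star s * s) * (a⁻ * d)) := by rw [← hs]
      _ = _ := by simp only [star_mul, mul_assoc]
  rw [hneg, neg_nonneg] at hx
  have hs0 : s * (a⁻ * d) = 0 :=
    CStarRing.star_mul_self_eq_zero_iff _ |>.mp (hx.antisymm (star_mul_self_nonneg _))
  have hnn : a⁻ * (a⁻ * d) = 0 := by
    calc a⁻ * (a⁻ * d) = star s * s * (a⁻ * d) := by rw [← hs]
      _ = 0 := by rw [mul_assoc, hs0, mul_zero]
  rw [← CStarRing.star_mul_self_eq_zero_iff, star_mul, hsa, mul_assoc, hnn, mul_zero]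

theorem stmt3 (J : Submodule ℂ A) (hJr : IsRightIdeal J) (hJc : IsClosed (J : Set A))
    (hJe : IsAlgEssential J) (a : A) :
    0 ≤ a ↔ ∀ x ∈ J, 0 ≤ star x * a * x := by
  refine ⟨fun ha x _ => star_left_conjugate_nonneg ha x, fun h => ?_⟩
  have hstar (x : A) (hx : x ∈ J) : star x * star a * x = star x * a * x := by
    simpa [mul_assoc] using (IsSelfAdjoint.of_nonneg (h x hx)).star_eq
  have hb : IsSelfAdjoint (Complex.I • (a - star a)) := by
    rw [isSelfAdjoint_iff]
    simp [star_smul, smul_sub, neg_add_eq_sub]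
  have hb0 (x : A) (hx : x ∈ J) : star x * (Complex.I • (a - star a)) * x = 0 := by
    rw [mul_smul_comm, smul_mul_assoc, mul_sub, sub_mul, hstar x hx, sub_self, smul_zero]
  have hpos := hJe.nonneg_of_isSelfAdjoint hb fun x hx => (hb0 x hx).ge
  have hneg := hJe.nonneg_of_isSelfAdjoint hb.neg fun x hx => by
    rw [mul_neg, neg_mul, hb0 x hx, neg_zero]
  have hzero := (neg_nonneg.mp hneg).antisymm hpos
  rw [smul_eq_zero_iff_right Complex.I_ne_zero, sub_eq_zero] at hzero
  exact hJe.nonneg_of_isSelfAdjoint hzero.symm h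
end

section
/- Let J be a closed right ideal of a C*-algebra A. Then J is algebraically essential if and only if J ∩ K ≠ {0} for every nonzero closed right ideal K of A. -/
variable {A : Type*} [NonUnitalCStarAlgebra A]

/-- A nonzero self-adjoint `a` has a continuous functional calculus factor `b` such that
`a * b` acts as a left unit on some nonzero element. -/
theorem IsSelfAdjoint.exists_mul_mul_eq_self {a : A} (ha : IsSelfAdjoint a) (ha0 : a ≠ 0) :
    ∃ b c : A, c ≠ 0 ∧ a * b * c = c := by
  obtain ⟨t, ht, ht0⟩ : ∃ t ∈ quasispectrum ℝ a, t ≠ 0 := by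
    by_contra! h
    apply ha0
    rw [← cfcₙ_id' ℝ a, cfcₙ_congr (g := fun _ => 0) (fun x hx => h x hx), cfcₙ_const_zero]
  have ht' : 0 < |t| := abs_pos.mpr ht0
  have hpos (x : ℝ) : 0 < max |x| (|t| / 2) := lt_max_of_lt_right (by linarith)
  let k : ℝ → ℝ := fun x => x / max |x| (|t| / 2) ^ 2
  let f : ℝ → ℝ := fun x => max (|x| - |t| / 2) 0
  have hk : Continuous k :=
    continuous_id.div (by fun_prop) fun x => (pow_pos (hpos x) 2).ne'
  have hf : Continuous f := by fun_prop
  have hk0 : k 0 = 0 := by simp [k]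
  have hf0 : f 0 = 0 := max_eq_right (by rw [abs_zero]; linarith)
  have hkf (x : ℝ) : x * k x * f x = f x := by
    rcases le_total |x| (|t| / 2) with h | h
    · have : f x = 0 := max_eq_right (by linarith)
      simp [this]
    · have hx : x ≠ 0 := abs_pos.mp (by linarith)
      have : x * k x = 1 := by
        simp only [k, max_eq_left h, sq_abs]
        field_simp
      rw [this, one_mul]
  refine ⟨cfcₙ k a, cfcₙ f a, fun h => ?_, ?_⟩
  · rw [← cfcₙ_const_zero ℝ a] at h
    have : f t = 0 := (cfcₙ_eq_cfcₙ_iff_eqOn (R := ℝ) (a := a) ha hf.continuousOn hf0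
      continuousOn_const rfl).mp h ht
    have h2 : |t| - |t| / 2 ≤ f t := le_max_left _ _
    linarith
  · calc a * cfcₙ k a * cfcₙ f a = cfcₙ (fun x : ℝ => x) a * cfcₙ k a * cfcₙ f a := by
          rw [cfcₙ_id' ℝ a]
      _ = cfcₙ (fun x => x * k x * f x) a := by
          rw [← cfcₙ_mul (fun x : ℝ => x) k a (by fun_prop) rfl hk.continuousOn hk0,
            ← cfcₙ_mul (fun x : ℝ => x * k x) f a (by fun_prop) (by simp) hf.continuousOn hf0]
      _ = cfcₙ f a := by simp only [hkf]

/-- Every nonzero right ideal contains a nonzero closed right ideal. -/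
theorem IsRightIdeal.exists_isClosed_le {K : Submodule ℂ A} (hK : IsRightIdeal K) (hK0 : K ≠ ⊥) :
    ∃ L : Submodule ℂ A, IsRightIdeal L ∧ IsClosed (L : Set A) ∧ L ≠ ⊥ ∧ L ≤ K := by
  obtain ⟨x, hx, hx0⟩ := K.exists_mem_ne_zero_of_ne_bot hK0
  obtain ⟨b, c, hc0, hc⟩ := (IsSelfAdjoint.mul_star_self x).exists_mul_mul_eq_self
    (CStarRing.mul_star_self_ne_zero_iff x |>.mpr hx0)
  let L : Submodule ℂ A := LinearMap.eqLocus (LinearMap.mulLeft ℂ (x * star x * b)) LinearMap.id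
  have hL (y : A) : y ∈ L ↔ x * star x * b * y = y := Iff.rfl
  refine ⟨L, fun y hy a => ?_, ?_, ?_, fun y hy => ?_⟩
  · rw [hL] at hy ⊢
    rw [← mul_assoc, hy]
  · exact isClosed_eq (continuous_const_mul (x * star x * b)) continuous_id
  · exact (Submodule.ne_bot_iff L).mpr ⟨c, hc, hc0⟩
  · rw [← (hL y).mp hy]
    simp only [mul_assoc]
    exact hK x hx _

theorem stmt5 (J : Submodule ℂ A) (hJr : IsRightIdeal J) (hJc : IsClosed (J : Set A)) :
    IsAlgEssential J ↔
      ∀ K : Submodule ℂ A, IsRightIdeal K → IsClosed (K : Set A) → K ≠ ⊥ → J ⊓ K ≠ ⊥ := by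
  refine ⟨fun h K hK _ hK0 => h K hK hK0, fun h K hK hK0 => ?_⟩
  obtain ⟨L, hL, hLc, hL0, hLK⟩ := hK.exists_isClosed_le hK0
  exact ne_bot_of_le_ne_bot (h L hL hLc hL0) (inf_le_inf_left J hLK)
end

section
/- Let J be an algebraically essential closed right ideal of a C*-algebra A and let (e_α) be an approximate identity of the hereditary C*-subalgebra J ∩ J*. Then for every a ∈ A one has ‖a‖ = sup_α ‖a e_α‖ = sup_α ‖e_α a‖. -/
open Filter

variable {A : Type*} [NonUnitalCStarAlgebra A] [PartialOrder A] [StarOrderedRing A]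

/-- `e : ι → A` is an approximate identity of the hereditary C*-subalgebra `J ∩ J*`:
an increasing net of positive elements of `J ∩ J*`, of norm at most one, with
`e i * x → x` for every `x ∈ J ∩ J*`. -/
structure IsApproxIdentity {ι : Type*} [Preorder ι] (J : Submodule ℂ A) (e : ι → A) : Prop where
  mem : ∀ i, e i ∈ J ∧ star (e i) ∈ J
  nonneg : ∀ i, 0 ≤ e i
  norm_le_one : ∀ i, ‖e i‖ ≤ 1
  mono : Monotone e
  tendsto : ∀ x : A, x ∈ J → star x ∈ J →
    Tendsto (fun i => e i * x) atTop (nhds x)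

/-- If `e` is an approximate identity of `J ∩ J*`, then `e i * y → y` for every `y` in `J`. -/
lemma IsApproxIdentity.tendsto_mul_of_mem {ι : Type*} [Preorder ι] {J : Submodule ℂ A}
    {e : ι → A} (he : IsApproxIdentity J e) (hJr : IsRightIdeal J) {y : A} (hy : y ∈ J) :
    Tendsto (fun i => e i * y) atTop (nhds y) := by
  have hz := he.tendsto (y * star y) (hJr y hy _) (by simpa using hJr y hy (star y))
  rw [tendsto_iff_norm_sub_tendsto_zero] at hz ⊢
  have hbound : ∀ i, ‖e i * y - y‖ ≤ √(2 * ‖e i * (y * star y) - y * star y‖) := by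
    intro i
    refine Real.le_sqrt_of_sq_le ?_
    have hfac : (e i * y - y) * star (e i * y - y) =
        (e i * (y * star y) - y * star y) * star (e i) - (e i * (y * star y) - y * star y) := by
      simp only [star_sub, star_mul, sub_mul, mul_sub, mul_assoc]
    rw [sq, ← CStarRing.norm_self_mul_star, hfac, two_mul]
    refine (norm_sub_le _ _).trans (add_le_add ?_ le_rfl)
    refine (norm_mul_le _ _).trans (mul_le_of_le_one_right (norm_nonneg _) ?_)
    simpa using he.norm_le_one i
  refine squeeze_zero (fun _ => norm_nonneg _) hbound ?_
  simpa using (hz.const_mul 2).sqrt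

/-- Spectral cut-off: above any level `c < ‖h‖`, a positive element `h` has a nonzero positive
part, on which `h` acts as `c` plus that positive part. -/
lemma exists_nonneg_ne_zero_mul_eq_smul_add {h : A} (hh : 0 ≤ h) {c : ℝ} (hc : 0 ≤ c)
    (hch : c < ‖h‖) : ∃ b : A, 0 ≤ b ∧ b ≠ 0 ∧ h * b = c • b + b * b := by
  have hsa : IsSelfAdjoint h := .of_nonneg hh
  let f : ℝ → ℝ := fun t => max (t - c) 0
  have hf0 : f 0 = 0 := by simp [f, hc]
  have hf : Continuous f := by fun_prop
  refine ⟨cfcₙ f h, cfcₙ_nonneg fun t _ => le_max_right _ _, fun hb => ?_, ?_⟩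
  · have hmin : h = cfcₙ (fun t : ℝ => min t c) h := by
      have hsum : cfcₙ (fun t : ℝ => min t c + f t) h = h := by
        conv_rhs => rw [← cfcₙ_id' ℝ h]
        congr 1
        funext t
        rcases le_total t c with htc | htc <;> simp [f, htc]
      rw [cfcₙ_add (fun t : ℝ => min t c) f h (by fun_prop) (by simp [hc]) hf.continuousOn hf0,
        hb, add_zero] at hsum
      exact hsum.symm
    refine hch.not_ge ?_
    rw [hmin]
    refine norm_cfcₙ_le fun t ht => ?_
    rw [Real.norm_of_nonneg (le_min (quasispectrum_nonneg_of_nonneg h hh t ht) hc)]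
    exact min_le_right _ _
  · conv_lhs => enter [1]; rw [← cfcₙ_id' ℝ h]
    rw [← cfcₙ_mul (fun t : ℝ => t) f h (by fun_prop) rfl hf.continuousOn hf0,
      ← cfcₙ_mul f f h hf.continuousOn hf0 hf.continuousOn hf0,
      ← cfcₙ_smul c f h hf.continuousOn hf0,
      ← cfcₙ_add (fun t => c • f t) (fun t => f t * f t) h
        (by fun_prop) (by simp [hf0]) (by fun_prop) (by simp [hf0])]
    congr 1
    funext t
    rcases le_total t c with htc | htc
    · simp [f, htc]
    · simp [f, htc]
      ring

/-- An algebraically essential right ideal contains a nonzero element of `b A` for every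
nonzero `b`. -/
lemma IsAlgEssential.exists_mul_mem {J : Submodule ℂ A} (hJe : IsAlgEssential J) {b : A}
    (hb : b ≠ 0) : ∃ x : A, b * x ∈ J ∧ b * x ≠ 0 := by
  have hne : LinearMap.range (LinearMap.mulLeft ℂ b) ≠ ⊥ := by
    intro hbot
    have : b * star b ∈ LinearMap.range (LinearMap.mulLeft ℂ b) := ⟨star b, rfl⟩
    rw [hbot, Submodule.mem_bot, CStarRing.mul_star_self_eq_zero_iff] at this
    exact hb this
  have hright : IsRightIdeal (LinearMap.range (LinearMap.mulLeft ℂ b)) := by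
    rintro _ ⟨x, rfl⟩ a
    exact ⟨x * a, by simp [mul_assoc]⟩
  obtain ⟨y, ⟨hyJ, x, rfl⟩, hy⟩ := Submodule.exists_mem_ne_zero_of_ne_bot (hJe _ hright hne)
  exact ⟨x, hyJ, hy⟩

/-- An algebraically essential right ideal contains nonzero vectors on which left multiplication
by `a` almost attains its norm. -/
lemma IsAlgEssential.exists_mul_norm_le {J : Submodule ℂ A} (hJe : IsAlgEssential J) {a : A}
    {s : ℝ} (hs : 0 ≤ s) (hsa : s < ‖a‖) : ∃ y ∈ J, y ≠ 0 ∧ s * ‖y‖ ≤ ‖a * y‖ := by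
  have hlt : s ^ 2 < ‖star a * a‖ := by
    rw [CStarRing.norm_star_mul_self, ← sq]
    gcongr
  obtain ⟨b, hb, hb0, hab⟩ :=
    exists_nonneg_ne_zero_mul_eq_smul_add (star_mul_self_nonneg a) (sq_nonneg s) hlt
  obtain ⟨x, hxJ, hx⟩ := hJe.exists_mul_mem hb0
  refine ⟨b * x, hxJ, hx, ?_⟩
  have hsb : star b = b := IsSelfAdjoint.of_nonneg hb
  have heq : star (a * (b * x)) * (a * (b * x)) =
      s ^ 2 • (star (b * x) * (b * x)) + star (b * x) * (b * (b * x)) := by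
    calc star (a * (b * x)) * (a * (b * x))
        = star (b * x) * (star a * a * b * x) := by simp only [star_mul, mul_assoc]
      _ = _ := by rw [hab, add_mul, mul_add, smul_mul_assoc, mul_smul_comm, mul_assoc b b x]
  have hnn : 0 ≤ star (b * x) * (b * (b * x)) := by
    simpa only [mul_assoc] using star_left_conjugate_nonneg hb (b * x)
  have hle : ‖s ^ 2 • (star (b * x) * (b * x))‖ ≤ ‖star (a * (b * x)) * (a * (b * x))‖ := by
    refine CStarAlgebra.norm_le_norm_of_nonneg_of_le
      (smul_nonneg (sq_nonneg s) (star_mul_self_nonneg _)) ?_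
    rw [heq]
    exact le_add_of_nonneg_right hnn
  rw [norm_smul, CStarRing.norm_star_mul_self, CStarRing.norm_star_mul_self,
    Real.norm_of_nonneg (sq_nonneg s)] at hle
  refine le_of_sq_le_sq ?_ (norm_nonneg _)
  linarith

/-- The norm of `a` is the supremum of the norms `‖a * e i‖`. -/
lemma IsApproxIdentity.norm_eq_iSup_norm_mul {ι : Type*} [Preorder ι] [Nonempty ι]
    [IsDirected ι (· ≤ ·)] {J : Submodule ℂ A} {e : ι → A} (he : IsApproxIdentity J e)
    (hJr : IsRightIdeal J) (hJe : IsAlgEssential J) (a : A) : ‖a‖ = ⨆ i, ‖a * e i‖ := by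
  have hle : ∀ i, ‖a * e i‖ ≤ ‖a‖ := fun i =>
    (norm_mul_le _ _).trans (mul_le_of_le_one_right (norm_nonneg _) (he.norm_le_one i))
  have hbdd : BddAbove (Set.range fun i => ‖a * e i‖) := ⟨‖a‖, by rintro _ ⟨i, rfl⟩; exact hle i⟩
  refine le_antisymm (le_of_not_gt fun hlt => ?_) (ciSup_le hle)
  obtain ⟨s, hs, hsa⟩ := exists_between hlt
  have hs0 : 0 ≤ s := (Real.iSup_nonneg fun i => norm_nonneg _).trans hs.le
  obtain ⟨y, hyJ, hy, hsy⟩ := hJe.exists_mul_norm_le hs0 hsa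
  have hlim : ‖a * y‖ ≤ (⨆ i, ‖a * e i‖) * ‖y‖ := by
    refine le_of_tendsto ((he.tendsto_mul_of_mem hJr hyJ).const_mul a).norm (.of_forall fun i => ?_)
    rw [← mul_assoc]
    exact (norm_mul_le _ _).trans
      (mul_le_mul_of_nonneg_right (le_ciSup hbdd i) (norm_nonneg y))
  exact hs.not_ge (le_of_mul_le_mul_right (hsy.trans hlim) (norm_pos_iff.mpr hy))

theorem stmt6 {ι : Type*} [Preorder ι] [Nonempty ι] [IsDirected ι (· ≤ ·)]
    (J : Submodule ℂ A) (hJr : IsRightIdeal J) (hJc : IsClosed (J : Set A))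
    (hJe : IsAlgEssential J)
    (e : ι → A) (he : IsApproxIdentity J e) (a : A) :
    ‖a‖ = ⨆ i, ‖a * e i‖ ∧ ‖a‖ = ⨆ i, ‖e i * a‖ := by
  refine ⟨he.norm_eq_iSup_norm_mul hJr hJe a, ?_⟩
  rw [← norm_star a, he.norm_eq_iSup_norm_mul hJr hJe (star a)]
  refine iSup_congr fun i => ?_
  rw [← norm_star (e i * a), star_mul, (IsSelfAdjoint.of_nonneg (he.nonneg i)).star_eq]
end

section
/- Let A be a C*-algebra and let a, b ∈ A. There exists a bounded right A-module map f from the norm closure of aA = {ax : x ∈ A} into A satisfying f(ax) = bx for all x ∈ A if and only if there exists γ > 0 such that b*b ≤ γ·(a*a). -/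
variable {A : Type*} [NonUnitalCStarAlgebra A] [PartialOrder A] [StarOrderedRing A]

/-- The norm closure of the right ideal `aA = {a * x : x ∈ A}`. -/
def closRight (a : A) : Set A :=
  closure {y : A | ∃ x : A, y = a * x}

open scoped CStarAlgebra

lemma Unitization.exists_inr_eq_inr_mul {A : Type*} [NonUnitalCStarAlgebra A]
    (b : A) (x : A⁺¹) : ∃ y : A, (y : A⁺¹) = (b : A⁺¹) * x :=
  ⟨((b : A⁺¹) * x).snd, by ext <;> simp⟩

lemma Unitization.exists_inr_eq_mul_inr {A : Type*} [NonUnitalCStarAlgebra A]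
    (x : A⁺¹) (b : A) : ∃ y : A, (y : A⁺¹) = x * (b : A⁺¹) :=
  ⟨(x * (b : A⁺¹)).snd, by ext <;> simp⟩

/-- A comparison of norms of right multiples extends from `A` to its unitization. -/
lemma norm_inr_mul_le_of_norm_mul_le {A : Type*} [NonUnitalCStarAlgebra A]
    {a b : A} (h : ∀ x : A, ‖b * x‖ ≤ ‖a * x‖) (x : A⁺¹) :
    ‖(b : A⁺¹) * x‖ ≤ ‖(a : A⁺¹) * x‖ := by
  obtain ⟨y, hy⟩ := Unitization.exists_inr_eq_inr_mul b x
  obtain ⟨z, hz⟩ := Unitization.exists_inr_eq_mul_inr x (star y)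
  have key : ‖(y : A⁺¹)‖ * ‖(y : A⁺¹)‖ ≤ ‖(a : A⁺¹) * x‖ * ‖(y : A⁺¹)‖ :=
    calc ‖(y : A⁺¹)‖ * ‖(y : A⁺¹)‖ = ‖(y : A⁺¹) * star (y : A⁺¹)‖ :=
          CStarRing.norm_self_mul_star.symm
      _ = ‖((b * z : A) : A⁺¹)‖ := by
          rw [Unitization.inr_mul, hz, ← mul_assoc, ← hy, Unitization.inr_star]
      _ ≤ ‖((a * z : A) : A⁺¹)‖ := by
          rw [Unitization.norm_inr, Unitization.norm_inr]
          exact h z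
      _ = ‖(a : A⁺¹) * x * star (y : A⁺¹)‖ := by
          rw [Unitization.inr_mul, hz, ← mul_assoc, Unitization.inr_star]
      _ ≤ ‖(a : A⁺¹) * x‖ * ‖(y : A⁺¹)‖ := by
          simpa only [norm_star] using norm_mul_le ((a : A⁺¹) * x) (star (y : A⁺¹))
  rw [← hy]
  rcases (norm_nonneg (y : A⁺¹)).eq_or_lt with h0 | h0
  · rw [← h0]
    exact norm_nonneg _
  · exact le_of_mul_le_mul_right key h0

lemma norm_sqrt_star_mul_self_mul {B : Type*} [CStarAlgebra B] [PartialOrder B] [StarOrderedRing B]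
    (a x : B) : ‖CFC.sqrt (star a * a) * x‖ = ‖a * x‖ := by
  have hs : IsSelfAdjoint (CFC.sqrt (star a * a)) := .of_nonneg (CFC.sqrt_nonneg _)
  have hm : CFC.sqrt (star a * a) * CFC.sqrt (star a * a) = star a * a :=
    CFC.sqrt_mul_sqrt_self _ (star_mul_self_nonneg a)
  refine (mul_self_inj (norm_nonneg _) (norm_nonneg _)).mp ?_
  rw [← CStarRing.norm_star_mul_self, ← CStarRing.norm_star_mul_self, star_mul, star_mul, hs.star_eq,
    mul_assoc, ← mul_assoc _ _ x, hm, mul_assoc, mul_assoc]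

lemma star_mul_self_le_of_norm_mul_le_of_unital {B : Type*} [CStarAlgebra B] [PartialOrder B]
    [StarOrderedRing B] {a b : B} (h : ∀ x : B, ‖b * x‖ ≤ ‖a * x‖) :
    star b * b ≤ star a * a := by
  have hε : ∀ ε : ℝ, 0 < ε → star b * b ≤ star a * a + algebraMap ℝ B ε := by
    intro ε hε
    have hp : IsStrictlyPositive (star a * a + algebraMap ℝ B ε) :=
      IsStrictlyPositive.nonneg_add (star_mul_self_nonneg a)
        (isStrictlyPositive_algebraMap hε)
    rw [le_iff_norm_sqrt_mul_rpow _ _ (star_mul_self_nonneg b) hp,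
      norm_sqrt_star_mul_self_mul]
    refine (h _).trans ?_
    rw [← norm_sqrt_star_mul_self_mul,
      ← le_iff_norm_sqrt_mul_rpow _ _ (star_mul_self_nonneg a) hp]
    exact le_add_of_nonneg_right (algebraMap_nonneg B hε.le)
  have hc : Continuous fun ε : ℝ => star a * a + algebraMap ℝ B ε := by fun_prop
  have ht := (hc.tendsto 0).mono_left (nhdsWithin_le_nhds (s := Set.Ioi 0))
  simp only [map_zero, add_zero] at ht
  exact ge_of_tendsto ht (Filter.eventually_of_mem self_mem_nhdsWithin hε)

/-- In a C⋆-algebra, `star b * b ≤ star a * a` as soon as `‖b * x‖ ≤ ‖a * x‖` for all `x`. -/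
lemma star_mul_self_le_of_norm_mul_le {a b : A} (h : ∀ x : A, ‖b * x‖ ≤ ‖a * x‖) :
    star b * b ≤ star a * a := by
  rw [← Unitization.inr_le_iff _ _ (.star_mul_self b) (.star_mul_self a)]
  simpa only [Unitization.inr_mul, Unitization.inr_star] using
    star_mul_self_le_of_norm_mul_le_of_unital (norm_inr_mul_le_of_norm_mul_le h)

lemma norm_mul_le_of_star_mul_self_le {a b : A} (h : star b * b ≤ star a * a) (x : A) :
    ‖b * x‖ ≤ ‖a * x‖ := by
  have hx : star (b * x) * (b * x) ≤ star (a * x) * (a * x) := by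
    simpa only [star_mul, mul_assoc] using star_left_conjugate_le_conjugate h x
  have hn := CStarAlgebra.norm_le_norm_of_nonneg_of_le (star_mul_self_nonneg (b * x)) hx
  rw [CStarRing.norm_star_mul_self, CStarRing.norm_star_mul_self] at hn
  exact (mul_self_le_mul_self_iff (norm_nonneg _) (norm_nonneg _)).mpr hn

lemma star_smul_mul_smul_self {A : Type*} [NonUnitalCStarAlgebra A]
    (c : ℝ) (a : A) :
    star ((c : ℂ) • a) * ((c : ℂ) • a) = ((c ^ 2 : ℝ) : ℂ) • (star a * a) := by
  rw [star_smul, smul_mul_smul_comm, Complex.star_def, Complex.conj_ofReal, sq, Complex.ofReal_mul]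

lemma closRight_eq_topologicalClosure {A : Type*} [NonUnitalCStarAlgebra A]
    (a : A) :
    closRight a = ((LinearMap.range (LinearMap.mulLeft ℂ a)).topologicalClosure : Set A) := by
  rw [Submodule.topologicalClosure_coe, closRight]
  congr 1
  ext y
  simp [eq_comm]

/-- The extension of `a * x ↦ b * x` to the closure of the right ideal generated by `a`. -/
lemma exists_clm_of_norm_mul_le {A : Type*} [NonUnitalCStarAlgebra A]
    {a b : A} {C : ℝ} (h : ∀ x : A, ‖b * x‖ ≤ C * ‖a * x‖)
    {M : Submodule ℂ A} (hM : M = LinearMap.range (LinearMap.mulLeft ℂ a)) :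
    ∃ g : M.topologicalClosure →L[ℂ] A,
      ∀ x (hx : a * x ∈ M.topologicalClosure), g ⟨a * x, hx⟩ = b * x := by
  let e : A →ₗ[ℂ] M.topologicalClosure := (LinearMap.mulLeft ℂ a).codRestrict _
    fun x => M.le_topologicalClosure (hM ▸ ⟨x, rfl⟩)
  have hd : DenseRange e := by
    intro z
    rw [closure_subtype]
    have hz : (z : A) ∈ closure (M : Set A) := z.2
    refine closure_mono ?_ hz
    intro _ hy
    rw [hM] at hy
    obtain ⟨x, rfl⟩ := hy
    exact ⟨e x, ⟨x, rfl⟩, rfl⟩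
  exact ⟨(LinearMap.mulLeft ℂ b).extendOfNorm e, fun x _ =>
    LinearMap.extendOfNorm_eq (f := LinearMap.mulLeft ℂ b) hd ⟨C, h⟩ x⟩

theorem stmt8 (a b : A) :
    (∃ f : A → A,
      (∀ x ∈ closRight a, ∀ y ∈ closRight a, f (x + y) = f x + f y) ∧
      (∀ c : ℂ, ∀ x ∈ closRight a, f (c • x) = c • f x) ∧
      (∀ x ∈ closRight a, ∀ r : A, f (x * r) = f x * r) ∧
      (∃ C : ℝ, ∀ x ∈ closRight a, ‖f x‖ ≤ C * ‖x‖) ∧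
      (∀ x : A, f (a * x) = b * x)) ↔
    ∃ γ : ℝ, 0 < γ ∧ star b * b ≤ (γ : ℂ) • (star a * a) := by
  constructor
  · rintro ⟨f, -, -, -, ⟨C, hC⟩, hf⟩
    have hD : 0 < max C 1 := lt_max_of_lt_right one_pos
    refine ⟨max C 1 ^ 2, by positivity, ?_⟩
    rw [← star_smul_mul_smul_self]
    refine star_mul_self_le_of_norm_mul_le fun x => ?_
    rw [smul_mul_assoc, norm_smul, Complex.norm_real, Real.norm_of_nonneg hD.le, ← hf]
    exact (hC _ (subset_closure ⟨x, rfl⟩)).trans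
      (mul_le_mul_of_nonneg_right (le_max_left C 1) (norm_nonneg _))
  · rintro ⟨γ, hγ, h⟩
    have hb (x : A) : ‖b * x‖ ≤ √γ * ‖a * x‖ := by
      rw [← Real.sq_sqrt hγ.le, ← star_smul_mul_smul_self] at h
      simpa [smul_mul_assoc, norm_smul, abs_of_nonneg (Real.sqrt_nonneg γ)] using
        norm_mul_le_of_star_mul_self_le h x
    obtain ⟨M, hM⟩ : ∃ M, M = LinearMap.range (LinearMap.mulLeft ℂ a) := ⟨_, rfl⟩
    have hmem {y : A} : y ∈ M ↔ ∃ x, a * x = y := by simp [hM]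
    have hcl : closRight a = (M.topologicalClosure : Set A) :=
      hM ▸ closRight_eq_topologicalClosure a
    obtain ⟨g, hg⟩ := exists_clm_of_norm_mul_le hb hM
    simp only [hcl, SetLike.mem_coe]
    have ha (x : A) : a * x ∈ M.topologicalClosure := M.le_topologicalClosure (hmem.2 ⟨x, rfl⟩)
    have hr (r : A) : ∀ x ∈ M.topologicalClosure, x * r ∈ M.topologicalClosure := by
      intro x hx
      refine map_mem_closure (f := (· * r)) (continuous_mul_const r) hx ?_
      intro _ hz
      obtain ⟨y, rfl⟩ := hmem.1 hz
      exact hmem.2 ⟨y * r, (mul_assoc a y r).symm⟩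
    have hmul (r : A) (z : M.topologicalClosure) : g ⟨z * r, hr r z z.2⟩ = g z * r := by
      obtain ⟨z, hz⟩ := z
      have hclosed : IsClosed {z : M.topologicalClosure | g ⟨z * r, hr r z z.2⟩ = g z * r} :=
        isClosed_eq (by fun_prop) (by fun_prop)
      have hsub : closure (((↑) : M.topologicalClosure → A) ⁻¹' (M : Set A)) ⊆
          {z : M.topologicalClosure | g ⟨z * r, hr r z z.2⟩ = g z * r} := by
        refine closure_minimal ?_ hclosed
        rintro ⟨_, hy⟩ hz
        obtain ⟨y, rfl⟩ := hmem.1 hz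
        have h1 := hg (y * r) (ha _)
        simp only [← mul_assoc] at h1
        exact h1.trans (congrArg (· * r) (hg y (ha y)).symm)
      refine hsub ?_
      rw [closure_subtype]
      have hz' : z ∈ closure (M : Set A) := hz
      refine closure_mono ?_ hz'
      exact fun y hy => ⟨⟨y, M.le_topologicalClosure hy⟩, hy, rfl⟩
    classical
    refine ⟨fun x => if hx : x ∈ M.topologicalClosure then g ⟨x, hx⟩ else 0, ?_, ?_, ?_, ?_, ?_⟩
    · intro x hx y hy
      simp only [hx, hy, add_mem hx hy, dif_pos]
      exact map_add g ⟨x, hx⟩ ⟨y, hy⟩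
    · intro c x hx
      simp only [hx, M.topologicalClosure.smul_mem c hx, dif_pos]
      exact map_smul g c ⟨x, hx⟩
    · intro x hx r
      simp only [hx, hr r x hx, dif_pos]
      exact hmul r ⟨x, hx⟩
    · refine ⟨‖g‖, fun x hx => ?_⟩
      simp only [hx, dif_pos]
      exact g.le_opNorm ⟨x, hx⟩
    · intro x
      simp only [ha x, dif_pos]
      exact hg x (ha x)
end
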